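/- There exist constants H(α,γ) ≥ 0 and ψ(α) ≥ 0 (depending only on α, γ and (E,μ)) such that for every x ≥ 0, every k ∈ E and every t ≥ 1: Z*(α,γ,x,k,t) ≤ H(α,γ)·exp(ψ(α)·x)·Z*(α,γ,0,t). -/

import Mathlib

noncomputable section

/-- The function J*(β,x,t). -/
def Jstar (β x t : ℝ) : ℝ :=
  if β = 0 then Real.sqrt (2 / (Real.pi * t)) * x
  else Real.sqrt (2 / (Real.pi * t ^ 3)) * x / β ^ 2 +
    (if 0 < β then 2 * Real.sinh (β * x) * Real.exp (t * β ^ 2 / 2) else 0)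

/-- The function I*(β,γ,x,t), defined by cases. -/
def Istar (β γ x t : ℝ) : ℝ :=
  if β < 0 ∧ γ < 0 then
    Real.sqrt (2 / (Real.pi * t ^ 3)) * (x / (β * γ) + (|β| + |γ|) / (β ^ 2 * γ ^ 2))
  else if β = 0 ∧ γ < 0 then (1 / |γ|) * Real.sqrt (2 / (Real.pi * t))
  else if γ = 0 ∧ β < 0 then (1 / |β|) * Real.sqrt (2 / (Real.pi * t))
  else if β = 0 ∧ γ = 0 then 1
  else if 0 < β ∧ γ < β then
    (1 / (β - γ)) * Real.sqrt (2 / (Real.pi * t)) +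
      (2 * β / (β - γ)) * Real.exp (-β * x + t * β ^ 2 / 2)
  else if 0 < γ ∧ β < γ then
    (1 / (γ - β)) * Real.sqrt (2 / (Real.pi * t)) +
      (2 * γ / (γ - β)) * Real.exp (-γ * x + t * γ ^ 2 / 2)
  else
    γ * Real.sqrt (2 * t / Real.pi) +
      2 * (t * γ ^ 2 + 1) * Real.exp (-γ * x + t * γ ^ 2 / 2)

/-- `Z*(α,γ,x,k,t) = Σ_m μ_m I*(α_m,γ,x,t) + J*(α_k,x,t)`. -/
def Zstar {E : Type} [Fintype E] (μ : E → ℝ) (α : E → ℝ) (γ x : ℝ) (k : E) (t : ℝ) : ℝ :=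
  (∑ m, μ m * Istar (α m) γ x t) + Jstar (α k) x t

/-- The growth rate in `t` of `Jstar β x t`, a common lower bound for `Istar β γ 0 t`. -/
def growthRate (β t : ℝ) : ℝ :=
  if 0 < β then Real.exp (t * β ^ 2 / 2)
  else if β = 0 then Real.sqrt (2 / (Real.pi * t))
  else Real.sqrt (2 / (Real.pi * t ^ 3))

lemma sqrt_cube_le_sqrt {t : ℝ} (ht : 1 ≤ t) :
    Real.sqrt (2 / (Real.pi * t ^ 3)) ≤ Real.sqrt (2 / (Real.pi * t)) := by
  have hpi := Real.pi_pos
  have h : t ≤ t ^ 3 := le_self_pow₀ ht (by norm_num)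
  gcongr

lemma sqrt_two_div_pi_mul_le_one {t : ℝ} (ht : 1 ≤ t) :
    Real.sqrt (2 / (Real.pi * t)) ≤ 1 := by
  have hpi := Real.pi_pos
  rw [Real.sqrt_le_left zero_le_one, one_pow, div_le_one (by positivity)]
  nlinarith [Real.pi_gt_three]

lemma growthRate_nonneg (β t : ℝ) : 0 ≤ growthRate β t := by
  unfold growthRate
  split_ifs <;> positivity

lemma le_exp_self (x : ℝ) : x ≤ Real.exp x := by
  linarith [Real.add_one_le_exp x]

lemma two_mul_sinh_le_exp (y : ℝ) : 2 * Real.sinh y ≤ Real.exp y := by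
  rw [Real.sinh_eq]
  linarith [Real.exp_pos (-y)]

lemma Jstar_le_growthRate (β : ℝ) {x t : ℝ} (hx : 0 ≤ x) (ht : 1 ≤ t) :
    Jstar β x t ≤ (1 / β ^ 2 + 1) * Real.exp ((|β| + 1) * x) * growthRate β t := by
  have hx1 : x ≤ Real.exp ((|β| + 1) * x) :=
    (le_exp_self x).trans (Real.exp_le_exp.2 (by nlinarith [abs_nonneg β]))
  have hs3 := Real.sqrt_nonneg (2 / (Real.pi * t ^ 3))
  have hs31 := (sqrt_cube_le_sqrt ht).trans (sqrt_two_div_pi_mul_le_one ht)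
  unfold Jstar growthRate
  rcases lt_trichotomy β 0 with hβ | rfl | hβ
  · simp only [hβ.ne, hβ.not_gt, if_false, add_zero]
    calc _ = (1 / β ^ 2) * x * Real.sqrt (2 / (Real.pi * t ^ 3)) := by ring
      _ ≤ _ := by gcongr; linarith
  · simp only [lt_irrefl, if_false, if_true]
    calc _ = (1 / 0 ^ 2 + 1) * x * Real.sqrt (2 / (Real.pi * t)) := by norm_num; ring
      _ ≤ _ := by gcongr
  · simp only [hβ.ne', hβ, if_false, if_true]
    have hexp : 1 ≤ Real.exp (t * β ^ 2 / 2) := Real.one_le_exp (by positivity)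
    have hsinh : 2 * Real.sinh (β * x) ≤ Real.exp ((|β| + 1) * x) :=
      (two_mul_sinh_le_exp _).trans (Real.exp_le_exp.2 (by rw [abs_of_pos hβ]; linarith))
    calc _ ≤ Real.exp (t * β ^ 2 / 2) * Real.exp ((|β| + 1) * x) / β ^ 2 +
          Real.exp ((|β| + 1) * x) * Real.exp (t * β ^ 2 / 2) := by
            gcongr
            exact hs31.trans hexp
      _ = _ := by ring

lemma exists_growthRate_le_Istar_zero (β γ : ℝ) :
    ∃ c > 0, ∀ t ≥ (1:ℝ), c * growthRate β t ≤ Istar β γ 0 t := by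
  unfold Istar
  split_ifs with h1 h2 h3 h4 h5 h6
  · obtain ⟨hβ, hγ⟩ := h1
    have := abs_pos.2 hβ.ne
    have := abs_pos.2 hγ.ne
    have := sq_pos_of_neg hβ
    have := sq_pos_of_neg hγ
    refine ⟨(|β| + |γ|) / (β ^ 2 * γ ^ 2), by positivity, fun t _ => ?_⟩
    simp only [growthRate, hβ.not_gt, hβ.ne, if_false, zero_div, zero_add]
    exact (mul_comm _ _).le
  · obtain ⟨rfl, hγ⟩ := h2
    have := abs_pos.2 hγ.ne
    exact ⟨1 / |γ|, by positivity, fun t _ => by simp [growthRate]⟩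
  · obtain ⟨rfl, hβ⟩ := h3
    have := abs_pos.2 hβ.ne
    refine ⟨1 / |β|, by positivity, fun t ht => ?_⟩
    simp only [growthRate, hβ.not_gt, hβ.ne, if_false]
    exact mul_le_mul_of_nonneg_left (sqrt_cube_le_sqrt ht) (by positivity)
  · obtain ⟨rfl, rfl⟩ := h4
    refine ⟨1, one_pos, fun t ht => ?_⟩
    simpa [growthRate] using sqrt_two_div_pi_mul_le_one ht
  · obtain ⟨hβ, hγ⟩ := h5
    have := sub_pos.2 hγ
    refine ⟨2 * β / (β - γ), by positivity, fun t _ => ?_⟩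
    simp only [growthRate, hβ, if_true, mul_zero, zero_add]
    exact le_add_of_nonneg_left (by positivity)
  · obtain ⟨hγ, hβγ⟩ := h6
    have := sub_pos.2 hβγ
    rcases lt_or_ge 0 β with hβ | hβ
    · refine ⟨2 * γ / (γ - β), by positivity, fun t ht => ?_⟩
      simp only [growthRate, hβ, if_true, mul_zero, zero_add]
      refine le_trans ?_ (le_add_of_nonneg_left (by positivity))
      gcongr
    · refine ⟨1 / (γ - β), by positivity, fun t ht => ?_⟩
      refine le_trans ?_ (le_add_of_nonneg_right (by positivity))
      simp only [growthRate, hβ.not_gt, if_false]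
      gcongr
      split_ifs
      exacts [le_rfl, sqrt_cube_le_sqrt ht]
  · obtain ⟨rfl, hβ⟩ : β = γ ∧ 0 < β := by grind
    refine ⟨1, one_pos, fun t ht => ?_⟩
    simp only [growthRate, hβ, if_true, mul_zero, zero_add]
    refine le_trans ?_ (le_add_of_nonneg_left (by positivity))
    gcongr
    have : 0 ≤ t * β ^ 2 := by positivity
    linarith

lemma Istar_zero_nonneg (β γ : ℝ) {t : ℝ} (ht : 1 ≤ t) : 0 ≤ Istar β γ 0 t := by
  obtain ⟨c, hc, h⟩ := exists_growthRate_le_Istar_zero β γ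
  exact (mul_nonneg hc.le (growthRate_nonneg β t)).trans (h t ht)

lemma Istar_le_Istar_zero_of_nonneg {β γ x t : ℝ} (h : 0 ≤ β ∨ 0 ≤ γ) (hx : 0 ≤ x) (ht : 1 ≤ t) :
    Istar β γ x t ≤ Istar β γ 0 t := by
  have hβγ : ¬(β < 0 ∧ γ < 0) := fun h' => by grind
  unfold Istar
  split_ifs with h2 h3 h4 h5 h6
  · rfl
  · rfl
  · rfl
  · have := sub_pos.2 h5.2
    have := h5.1
    gcongr _ + _ * Real.exp (?_ + _)
    nlinarith
  · have := sub_pos.2 h6.2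
    have := h6.1
    gcongr _ + _ * Real.exp (?_ + _)
    nlinarith
  · have : 0 < γ := by grind
    gcongr _ + _ * Real.exp (?_ + _)
    nlinarith

lemma exists_Istar_le_Istar_zero (β γ : ℝ) :
    ∃ C ≥ (0:ℝ), ∀ x ≥ (0:ℝ), ∀ t ≥ (1:ℝ),
      Istar β γ x t ≤ C * Real.exp x * Istar β γ 0 t := by
  by_cases h : β < 0 ∧ γ < 0
  · obtain ⟨hβ, hγ⟩ := h
    have hβγ := mul_pos_of_neg_of_neg hβ hγ
    have := abs_pos.2 hβ.ne
    have := abs_pos.2 hγ.ne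
    have := sq_pos_of_neg hβ
    have := sq_pos_of_neg hγ
    set A := (|β| + |γ|) / (β ^ 2 * γ ^ 2) with hA
    have hApos : 0 < A := by positivity
    refine ⟨1 / (β * γ * A) + 1, by positivity, fun x hx t _ => ?_⟩
    simp only [Istar, hβ, hγ, and_self, if_true, ← hA, zero_div, zero_add]
    calc _ ≤ Real.sqrt (2 / (Real.pi * t ^ 3)) *
          (Real.exp x / (β * γ) + Real.exp x * A) := by
            gcongr
            · exact le_exp_self x
            · exact le_mul_of_one_le_left hApos.le (Real.one_le_exp hx)
      _ = _ := by field_simp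
  · refine ⟨1, zero_le_one, fun x hx t ht => ?_⟩
    refine (Istar_le_Istar_zero_of_nonneg (by grind) hx ht).trans ?_
    rw [one_mul]
    exact le_mul_of_one_le_left (Istar_zero_nonneg β γ ht) (Real.one_le_exp hx)

lemma exists_Jstar_le_Istar_zero (β γ : ℝ) :
    ∃ C ≥ (0:ℝ), ∀ x ≥ (0:ℝ), ∀ t ≥ (1:ℝ),
      Jstar β x t ≤ C * Real.exp ((|β| + 1) * x) * Istar β γ 0 t := by
  obtain ⟨c, hc, h⟩ := exists_growthRate_le_Istar_zero β γ
  refine ⟨(1 / β ^ 2 + 1) / c, by positivity, fun x hx t ht => ?_⟩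
  calc _ ≤ _ := Jstar_le_growthRate β hx ht
    _ = (1 / β ^ 2 + 1) / c * Real.exp ((|β| + 1) * x) * (c * growthRate β t) := by
      field_simp
    _ ≤ _ := by
      gcongr
      exact h t ht

/-- there are constants `H(α,γ) ≥ 0` and `ψ(α) ≥ 0` such that for every
`x ≥ 0`, `k ∈ E` and `t ≥ 1`, `Z*(α,γ,x,k,t) ≤ H(α,γ) exp(ψ(α) x) Z*(α,γ,0,t)`
(note `J*(β,0,t) = 0`, so `Z*(α,γ,0,k,t)` does not depend on `k`). -/
theorem stmt11 {E : Type} [Fintype E] [Nonempty E]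
    (μ : E → ℝ) (hμ : ∀ m, 0 < μ m) (hsum : ∑ m, μ m = 1) (α : E → ℝ) (γ : ℝ) :
    ∃ H ≥ (0:ℝ), ∃ ψ ≥ (0:ℝ), ∀ x ≥ (0:ℝ), ∀ k : E, ∀ t ≥ (1:ℝ),
      Zstar μ α γ x k t
        ≤ H * Real.exp (ψ * x) * (∑ m, μ m * Istar (α m) γ 0 t) := by
  choose C hC hI using fun m => exists_Istar_le_Istar_zero (α m) γ
  choose D hD hJ using fun m => exists_Jstar_le_Istar_zero (α m) γ
  have hDμ : ∀ m, 0 ≤ D m / μ m := fun m => div_nonneg (hD m) (hμ m).le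
  have hC' : 0 ≤ ∑ m, C m := Finset.sum_nonneg fun m _ => hC m
  have hD' : 0 ≤ ∑ m, D m / μ m := Finset.sum_nonneg fun m _ => hDμ m
  have hα : 0 ≤ ∑ m, |α m| := Finset.sum_nonneg fun m _ => abs_nonneg _
  refine ⟨(∑ m, C m) + ∑ m, D m / μ m, by positivity, (∑ m, |α m|) + 1, by positivity,
    fun x hx k t ht => ?_⟩
  have hnonneg : ∀ m ∈ Finset.univ, 0 ≤ μ m * Istar (α m) γ 0 t := fun m _ =>
    mul_nonneg (hμ m).le (Istar_zero_nonneg _ _ ht)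
  have hexp : Real.exp x ≤ Real.exp (((∑ m, |α m|) + 1) * x) :=
    Real.exp_le_exp.2 (by nlinarith)
  have hk : |α k| ≤ ∑ m, |α m| :=
    Finset.single_le_sum (f := fun m => |α m|) (fun m _ => abs_nonneg _) (Finset.mem_univ k)
  unfold Zstar
  rw [add_mul, add_mul]
  refine add_le_add ?_ ?_
  · rw [Finset.mul_sum]
    refine Finset.sum_le_sum fun m hm => ?_
    calc _ ≤ μ m * (C m * Real.exp x * Istar (α m) γ 0 t) :=
          mul_le_mul_of_nonneg_left (hI m x hx t ht) (hμ m).le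
      _ = C m * Real.exp x * (μ m * Istar (α m) γ 0 t) := by ring
      _ ≤ _ := by
        refine mul_le_mul_of_nonneg_right ?_ (hnonneg m hm)
        gcongr
        exact Finset.single_le_sum (fun m _ => hC m) hm
  · have hμk := (hμ k).ne'
    calc _ ≤ D k * Real.exp ((|α k| + 1) * x) * Istar (α k) γ 0 t := hJ k x hx t ht
      _ = D k / μ k * Real.exp ((|α k| + 1) * x) * (μ k * Istar (α k) γ 0 t) := by
        field_simp
      _ ≤ _ := by
        refine mul_le_mul ?_ (Finset.single_le_sum hnonneg (Finset.mem_univ k))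
          (hnonneg k (Finset.mem_univ k)) (by positivity)
        gcongr
        exact Finset.single_le_sum (f := fun m => D m / μ m) (fun m _ => hDμ m)
          (Finset.mem_univ k)

end
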